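/- arXiv:1911.07649 — 2 statements merged into one kernel-verified Lean document; each statement's English description precedes it below -/
import Mathlib

section
/- Perfect completeness of the (non-recursive) inner-product zero-knowledge proof: Let G be a commutative group, g, h ∈ G, and let g⃗, h⃗ : Fin n → G be vectors of group elements. Let a, b, sL, sR : Fin n → ℤ be integer vectors and α, ρ, γ, τ₁, τ₂, x ∈ ℤ. Define c = ⟨a, b⟩, t₁ = ⟨a, sR⟩ + ⟨sL, b⟩, t₂ = ⟨sL, sR⟩, and set V = g^c · h^γ, T₁ = g^{t₁} · h^{τ₁}, T₂ = g^{t₂} · h^{τ₂}, A = h^α · g⃗^a · h⃗^b, S = h^ρ · g⃗^{sL} · h⃗^{sR}. Let l = a + x·sL, r = b + x·sR, t̂ = ⟨l, r⟩, τₓ = τ₂·x² + τ₁·x + γ, and μ = α + ρ·x. Then all three verifier checks hold: (i) g^{t̂} · h^{τₓ} = V · T₁^x · T₂^{x²}; (ii) A · S^x = h^μ · g⃗^l · h⃗^r; (iii) t̂ = c + t₁·x + t₂·x². -/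
/-- Perfect completeness of the (non-recursive) inner-product zero-knowledge proof:
the honest prover's responses pass all three verifier checks. -/
theorem ipzkp_perfect_completeness
    {G : Type*} [CommGroup G] {n : ℕ}
    (g h : G) (gv hv : Fin n → G)
    (a b sL sR : Fin n → ℤ) (α ρ γ τ₁ τ₂ x : ℤ)
    (c t₁ t₂ : ℤ)
    (hc : c = ∑ i, a i * b i)
    (ht₁ : t₁ = (∑ i, a i * sR i) + ∑ i, sL i * b i)
    (ht₂ : t₂ = ∑ i, sL i * sR i)
    (V T₁ T₂ A S : G)
    (hV : V = g ^ c * h ^ γ)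
    (hT₁ : T₁ = g ^ t₁ * h ^ τ₁)
    (hT₂ : T₂ = g ^ t₂ * h ^ τ₂)
    (hA : A = h ^ α * (∏ i, (gv i) ^ (a i)) * ∏ i, (hv i) ^ (b i))
    (hS : S = h ^ ρ * (∏ i, (gv i) ^ (sL i)) * ∏ i, (hv i) ^ (sR i))
    (l r : Fin n → ℤ) (that τx μ : ℤ)
    (hl : l = fun i => a i + x * sL i)
    (hr : r = fun i => b i + x * sR i)
    (hthat : that = ∑ i, l i * r i)
    (hτx : τx = τ₂ * x ^ 2 + τ₁ * x + γ)
    (hμ : μ = α + ρ * x) :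
    g ^ that * h ^ τx = V * T₁ ^ x * T₂ ^ (x ^ 2) ∧
    A * S ^ x = h ^ μ * (∏ i, (gv i) ^ (l i)) * ∏ i, (hv i) ^ (r i) ∧
    that = c + t₁ * x + t₂ * x ^ 2 := by
  have h3 : that = c + t₁ * x + t₂ * x ^ 2 := by
    rw [hthat, hc, ht₁, ht₂, hl, hr, add_mul, Finset.sum_mul, Finset.sum_mul, Finset.sum_mul,
      ← Finset.sum_add_distrib, ← Finset.sum_add_distrib, ← Finset.sum_add_distrib]
    refine Finset.sum_congr rfl fun i _ => ?_
    ring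
  have key : ∀ (v : Fin n → G) (p q : Fin n → ℤ),
      ∏ i, v i ^ (p i + x * q i) = (∏ i, v i ^ p i) * (∏ i, v i ^ q i) ^ x := by
    intro v p q
    rw [← Finset.prod_zpow, ← Finset.prod_mul_distrib]
    refine Finset.prod_congr rfl fun i _ => ?_
    rw [zpow_add, mul_comm x, zpow_mul]
  refine ⟨?_, ?_, h3⟩
  · rw [h3, hV, hT₁, hT₂, hτx]
    simp only [zpow_add, mul_zpow, zpow_mul]
    ac_rfl
  · subst hl hr
    have e1 := key gv a sL
    have e2 := key hv b sR
    rw [hA, hS, hμ]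
    refine Eq.trans ?_ (congrArg₂ (fun u w => h ^ (α + ρ * x) * u * w) e1 e2).symm
    generalize (∏ i, gv i ^ a i) = p₁
    generalize (∏ i, gv i ^ sL i) = p₂
    generalize (∏ i, hv i ^ b i) = p₃
    generalize (∏ i, hv i ^ sR i) = p₄
    have fin : ∀ u₁ u₂ u₃ u₄ u₅ u₆ : G,
        u₁ * u₂ * u₃ * (u₄ * u₅ * u₆) = u₁ * u₄ * (u₂ * u₅) * (u₃ * u₆) := by
      intro u₁ u₂ u₃ u₄ u₅ u₆
      rw [mul_mul_mul_comm, mul_mul_mul_comm u₁]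
    have e3 : (h ^ ρ * p₂ * p₄) ^ x = (h ^ ρ) ^ x * p₂ ^ x * p₄ ^ x := by
      rw [mul_zpow, mul_zpow]
    have e4 : h ^ (α + ρ * x) = h ^ α * (h ^ ρ) ^ x := by
      rw [zpow_add, zpow_mul]
    rw [e3, e4]
    exact fin _ _ _ _ _ _
end

section
/- Extraction of T₂ from three accepting transcripts (knowledge-soundness support): Let G be a commutative group, g, h, V, T₁, T₂ ∈ G, and let c₁, c₂, c₃, y₁, y₂, y₃, z₁, z₂, z₃ ∈ ℤ. Suppose g^{yᵢ} · h^{zᵢ} = V · T₁^{cᵢ} · T₂^{cᵢ²} for i = 1, 2, 3. Then (E₁ · E₂⁻¹)^{c₁ - c₃} · (E₁ · E₃⁻¹)^{-(c₁ - c₂)} = T₂^{(c₁ - c₂)(c₁ - c₃)(c₂ - c₃)}, where Eᵢ := g^{yᵢ} · h^{zᵢ}. -/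
/-- Knowledge-soundness extractor support: from three accepting transcripts,
`T₂` can be isolated. Here `Eᵢ = g^{yᵢ} · h^{zᵢ}`. -/
theorem extractor_isolates_T2
    {G : Type*} [CommGroup G]
    (g h V T₁ T₂ : G) (c₁ c₂ c₃ y₁ y₂ y₃ z₁ z₂ z₃ : ℤ)
    (h₁ : g ^ y₁ * h ^ z₁ = V * T₁ ^ c₁ * T₂ ^ (c₁ ^ 2))
    (h₂ : g ^ y₂ * h ^ z₂ = V * T₁ ^ c₂ * T₂ ^ (c₂ ^ 2))
    (h₃ : g ^ y₃ * h ^ z₃ = V * T₁ ^ c₃ * T₂ ^ (c₃ ^ 2)) :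
    ((g ^ y₁ * h ^ z₁) * (g ^ y₂ * h ^ z₂)⁻¹) ^ (c₁ - c₃) *
      ((g ^ y₁ * h ^ z₁) * (g ^ y₃ * h ^ z₃)⁻¹) ^ (-(c₁ - c₂)) =
    T₂ ^ ((c₁ - c₂) * (c₁ - c₃) * (c₂ - c₃)) := by
  have key : ∀ a b : ℤ, (V * T₁ ^ a * T₂ ^ (a ^ 2)) * (V * T₁ ^ b * T₂ ^ (b ^ 2))⁻¹
      = T₁ ^ (a - b) * T₂ ^ (a ^ 2 - b ^ 2) := by
    intro a b
    rw [zpow_sub, zpow_sub, ← div_eq_mul_inv, mul_div_mul_comm, mul_div_mul_left_eq_div,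
      div_eq_mul_inv, div_eq_mul_inv]
  rw [h₁, h₂, h₃, key, key, mul_zpow, mul_zpow, ← zpow_mul, ← zpow_mul, ← zpow_mul, ← zpow_mul,
    mul_mul_mul_comm, ← zpow_add, ← zpow_add]
  have e1 : (c₁ - c₂) * (c₁ - c₃) + (c₁ - c₃) * -(c₁ - c₂) = 0 := by ring
  rw [e1, zpow_zero, one_mul]
  congr 1
  ring
end
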